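/- arXiv:math/0411308 — 2 statements merged into one kernel-verified Lean document; each statement's English description precedes it below -/
import Mathlib

section
/- For every K > 0 and every p ∈ (0,∞) there is a constant C > 0, depending only on K and p, such that for every C² subharmonic function ψ on the unit disk 𝔻 with Δψ ≤ K on 𝔻 and every holomorphic function f on 𝔻, one has ∫_{|z|<1} |f|^p e^{-pψ} dA ≤ C ∫_{1/2<|z|<1} |f|^p e^{-pψ} dA. -/
open MeasureTheory Metric Set
open scoped ENNReal Topology

noncomputable section

/-- The Laplacian `Δψ = ψ_{xx} + ψ_{yy}` of a function `ψ : ℂ → ℝ`, expressed through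
the second (real) derivative in the directions `1` and `i`. -/
def lap (ψ : ℂ → ℝ) (z : ℂ) : ℝ :=
  fderiv ℝ (fderiv ℝ ψ) z 1 1 + fderiv ℝ (fderiv ℝ ψ) z Complex.I Complex.I

theorem lap_eq_of_norm_eq_one {ψ : ℂ → ℝ} {z e : ℂ} (he : ‖e‖ = 1) :
    fderiv ℝ (fderiv ℝ ψ) z e e +
      fderiv ℝ (fderiv ℝ ψ) z (Complex.I * e) (Complex.I * e) = lap ψ z := by
  have h1 : e = e.re • (1 : ℂ) + e.im • Complex.I := by
    apply Complex.ext <;> simp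
  have h2 : Complex.I * e = (-e.im) • (1 : ℂ) + e.re • Complex.I := by
    apply Complex.ext <;> simp
  have h3 : e.re ^ 2 + e.im ^ 2 = 1 := by
    have := Complex.sq_norm e
    rw [he, Complex.normSq_apply] at this
    linarith
  rw [h2]
  set a := e.re
  set b := e.im
  rw [h1, lap]
  simp only [map_add, map_smul, add_apply, smul_apply,
    smul_eq_mul]
  linear_combination (fderiv ℝ (fderiv ℝ ψ) z 1 1 +
    fderiv ℝ (fderiv ℝ ψ) z Complex.I Complex.I) * h3

section Polar

variable {φ : ℂ → ℝ} {U : Set ℂ} {c : ℂ} {R : ℝ}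

theorem hasFDerivAt_exp_mul_I (x : ℝ × ℝ) :
    HasFDerivAt (fun y : ℝ × ℝ => Complex.exp (y.2 * Complex.I))
      ((ContinuousLinearMap.snd ℝ ℝ ℝ).smulRight
        (Complex.I * Complex.exp (x.2 * Complex.I))) x := by
  have h : HasDerivAt (fun t : ℝ => Complex.exp (t * Complex.I))
      (Complex.I * Complex.exp (x.2 * Complex.I)) x.2 := by
    have := ((Complex.ofRealCLM.hasDerivAt (x := x.2)).mul_const Complex.I).cexp
    simpa [mul_comm] using this
  exact h.hasFDerivAt.comp x hasFDerivAt_snd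

theorem hasFDerivAt_smul_exp_mul_I (x : ℝ × ℝ) :
    HasFDerivAt (fun y : ℝ × ℝ => y.1 • Complex.exp (y.2 * Complex.I))
      ((ContinuousLinearMap.fst ℝ ℝ ℝ).smulRight (Complex.exp (x.2 * Complex.I)) +
        (ContinuousLinearMap.snd ℝ ℝ ℝ).smulRight
          (x.1 • (Complex.I * Complex.exp (x.2 * Complex.I)))) x := by
  refine (hasFDerivAt_fst.smul (hasFDerivAt_exp_mul_I x)).congr_fderiv ?_
  ext <;> simp

theorem circleMap_eq_smul (c : ℂ) (r θ : ℝ) :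
    circleMap c r θ = c + r • Complex.exp (θ * Complex.I) := by
  simp [circleMap]

theorem hasFDerivAt_circleMap_prod (c : ℂ) (x : ℝ × ℝ) :
    HasFDerivAt (fun y : ℝ × ℝ => circleMap c y.1 y.2)
      ((ContinuousLinearMap.fst ℝ ℝ ℝ).smulRight (Complex.exp (x.2 * Complex.I)) +
        (ContinuousLinearMap.snd ℝ ℝ ℝ).smulRight
          (x.1 • (Complex.I * Complex.exp (x.2 * Complex.I)))) x := by
  simpa only [circleMap_eq_smul] using (hasFDerivAt_smul_exp_mul_I x).const_add c

theorem continuous_circleMap_prod (c : ℂ) :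
    Continuous (fun y : ℝ × ℝ => circleMap c y.1 y.2) :=
  continuous_iff_continuousAt.2 fun x => (hasFDerivAt_circleMap_prod c x).continuousAt

theorem mapsTo_circleMap_prod (hcR : closedBall c R ⊆ U) (hR : 0 ≤ R) :
    MapsTo (fun y : ℝ × ℝ => circleMap c y.1 y.2) (uIcc 0 R ×ˢ uIcc 0 (2 * Real.pi)) U := by
  rintro ⟨s, θ⟩ ⟨hs, -⟩
  rw [uIcc_of_le hR] at hs
  exact hcR (closedBall_subset_closedBall hs.2 (circleMap_mem_closedBall c hs.1 θ))

theorem continuousOn_fderiv_of_contDiffOn_two (hU : IsOpen U) (hφ : ContDiffOn ℝ 2 φ U) :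
    ContinuousOn (fderiv ℝ φ) U :=
  hφ.continuousOn_fderiv_of_isOpen hU (by norm_num)

theorem contDiffOn_fderiv_of_contDiffOn_two (hU : IsOpen U) (hφ : ContDiffOn ℝ 2 φ U) :
    ContDiffOn ℝ 1 (fderiv ℝ φ) U :=
  hφ.fderiv_of_isOpen hU (by norm_num)

theorem continuousOn_lap (hU : IsOpen U) (hφ : ContDiffOn ℝ 2 φ U) :
    ContinuousOn (lap φ) U := by
  have h := (contDiffOn_fderiv_of_contDiffOn_two hU hφ).continuousOn_fderiv_of_isOpen hU le_rfl
  unfold lap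
  exact ((h.clm_apply continuousOn_const).clm_apply continuousOn_const).add
    ((h.clm_apply continuousOn_const).clm_apply continuousOn_const)

theorem hasFDerivAt_fderiv (hU : IsOpen U) (hφ : ContDiffOn ℝ 2 φ U) {z : ℂ} (hz : z ∈ U) :
    HasFDerivAt (fderiv ℝ φ) (fderiv ℝ (fderiv ℝ φ) z) z :=
  (((contDiffOn_fderiv_of_contDiffOn_two hU hφ).differentiableOn one_ne_zero).differentiableAt
    (hU.mem_nhds hz)).hasFDerivAt

/-- The flux of the gradient of a function with nonnegative Laplacian through a circle is
nonnegative. -/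
theorem integral_fderiv_circleMap_nonneg (hU : IsOpen U) (hφ : ContDiffOn ℝ 2 φ U)
    (hlap : ∀ z ∈ U, 0 ≤ lap φ z) (hcR : closedBall c R ⊆ U) (hR : 0 < R) :
    0 ≤ ∫ θ in (0 : ℝ)..2 * Real.pi,
      fderiv ℝ φ (circleMap c R θ) (Complex.exp (θ * Complex.I)) := by
  have hmaps := mapsTo_circleMap_prod hcR hR.le
  have hD := (continuousOn_fderiv_of_contDiffOn_two hU hφ).comp
    (continuous_circleMap_prod c).continuousOn hmaps
  have hDP : ∀ x ∈ uIcc 0 R ×ˢ uIcc 0 (2 * Real.pi), HasFDerivAt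
      (fun y : ℝ × ℝ => fderiv ℝ φ (circleMap c y.1 y.2)) _ x := fun x hx =>
    (hasFDerivAt_fderiv hU hφ (hmaps hx)).comp x (hasFDerivAt_circleMap_prod c x)
  have hsub : Ioo (min 0 R) (max 0 R) ×ˢ Ioo (min 0 (2 * Real.pi)) (max 0 (2 * Real.pi)) ⊆
      uIcc 0 R ×ˢ uIcc 0 (2 * Real.pi) :=
    prod_mono Ioo_subset_Icc_self Ioo_subset_Icc_self
  have hF := fun x hx => (hDP x hx).clm_apply (hasFDerivAt_smul_exp_mul_I x)
  have hG := fun x hx => (hDP x hx).clm_apply ((hasFDerivAt_exp_mul_I x).const_mul Complex.I)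
  have key := integral2_divergence_prod_of_hasFDerivAt _ _ _ _ 0 0 R (2 * Real.pi)
    (hD.clm_apply (by fun_prop)) (hD.clm_apply (by fun_prop))
    (fun x hx => hF x (hsub hx)) (fun x hx => hG x (hsub hx))
  have heq : ∀ r θ : ℝ, fderiv ℝ φ (circleMap c r θ) (Complex.exp (θ * Complex.I)) +
      fderiv ℝ (fderiv ℝ φ) (circleMap c r θ) (Complex.exp (θ * Complex.I))
        (r * Complex.exp (θ * Complex.I)) +
      (fderiv ℝ φ (circleMap c r θ) (Complex.I * (Complex.I * Complex.exp (θ * Complex.I))) +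
      fderiv ℝ (fderiv ℝ φ) (circleMap c r θ) (r * (Complex.I * Complex.exp (θ * Complex.I)))
        (Complex.I * Complex.exp (θ * Complex.I))) = r * lap φ (circleMap c r θ) := by
    intro r θ
    rw [← lap_eq_of_norm_eq_one (Complex.norm_exp_ofReal_mul_I θ),
      ← mul_assoc Complex.I Complex.I, Complex.I_mul_I, neg_one_mul, map_neg]
    simp only [← Complex.real_smul, map_smul, smul_apply, smul_eq_mul]
    ring
  have hper : ∀ r : ℝ, circleMap c r (2 * Real.pi) = circleMap c r 0 := fun r => by
    simpa using periodic_circleMap c r 0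
  simp [heq, hper, -map_mul] at key
  have hlapc : ContinuousOn (fun x : ℝ × ℝ => x.1 * lap φ (circleMap c x.1 x.2))
      (uIcc 0 R ×ˢ uIcc 0 (2 * Real.pi)) :=
    continuousOn_fst.mul ((continuousOn_lap hU hφ).comp
      (continuous_circleMap_prod c).continuousOn hmaps)
  have hint := hlapc.integrableOn_compact (μ := volume) (isCompact_uIcc.prod isCompact_uIcc)
  rw [uIcc_prod_uIcc] at hint
  have key' := key hint
  have hsm : ∀ θ : ℝ, fderiv ℝ φ (circleMap c R θ) (R * Complex.exp (θ * Complex.I)) =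
      R * fderiv ℝ φ (circleMap c R θ) (Complex.exp (θ * Complex.I)) := fun θ => by
    rw [← Complex.real_smul, map_smul, smul_eq_mul]
  simp only [hsm, intervalIntegral.integral_const_mul] at key'
  refine (mul_nonneg_iff_of_pos_left hR).1 ?_
  rw [← key']
  refine intervalIntegral.integral_nonneg hR.le fun r hr =>
    mul_nonneg hr.1 (intervalIntegral.integral_nonneg Real.two_pi_pos.le fun θ hθ => ?_)
  exact hlap _ (hcR (closedBall_subset_closedBall hr.2 (circleMap_mem_closedBall c hr.1 θ)))

theorem le_circleAverage_of_lap_nonneg (hU : IsOpen U) (hφ : ContDiffOn ℝ 2 φ U)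
    (hlap : ∀ z ∈ U, 0 ≤ lap φ z) (hcR : closedBall c R ⊆ U) (hR : 0 < R) :
    φ c ≤ Real.circleAverage φ c R := by
  have hmaps := mapsTo_circleMap_prod hcR hR.le
  have hP := (continuous_circleMap_prod c).continuousOn (s := uIcc 0 R ×ˢ uIcc 0 (2 * Real.pi))
  have hexp : Continuous fun y : ℝ × ℝ => Complex.exp (y.2 * Complex.I) := by fun_prop
  have hsub : Ioo (min 0 R) (max 0 R) ×ˢ Ioo (min 0 (2 * Real.pi)) (max 0 (2 * Real.pi)) ⊆
      uIcc 0 R ×ˢ uIcc 0 (2 * Real.pi) :=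
    prod_mono Ioo_subset_Icc_self Ioo_subset_Icc_self
  have hF : ∀ x ∈ uIcc 0 R ×ˢ uIcc 0 (2 * Real.pi), HasFDerivAt
      (fun y : ℝ × ℝ => φ (circleMap c y.1 y.2)) _ x := fun x hx =>
    (((hφ.differentiableOn two_ne_zero).differentiableAt
      (hU.mem_nhds (hmaps hx))).hasFDerivAt).comp x (hasFDerivAt_circleMap_prod c x)
  have key := integral2_divergence_prod_of_hasFDerivAt _ (fun _ => (0 : ℝ)) _ (fun _ => 0)
    0 0 R (2 * Real.pi) (hφ.continuousOn.comp hP hmaps) continuousOn_const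
    (fun x hx => hF x (hsub hx)) (fun x _ => hasFDerivAt_const 0 x)
  simp at key
  have hint := (((continuousOn_fderiv_of_contDiffOn_two hU hφ).comp hP hmaps).clm_apply
    hexp.continuousOn).integrableOn_compact (μ := volume) (isCompact_uIcc.prod isCompact_uIcc)
  rw [uIcc_prod_uIcc] at hint
  have h : 0 ≤ (∫ θ in (0 : ℝ)..2 * Real.pi, φ (circleMap c R θ)) - 2 * Real.pi * φ c := by
    rw [← key hint]
    rw [intervalIntegral.integral_of_le hR.le]
    exact setIntegral_nonneg measurableSet_Ioc fun r hr =>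
      integral_fderiv_circleMap_nonneg hU hφ hlap
        ((closedBall_subset_closedBall hr.2).trans hcR) hr.1
  rw [Real.circleAverage, smul_eq_mul, inv_mul_eq_div, le_div_iff₀ Real.two_pi_pos]
  linarith

end Polar

section SubMean

variable {φ : ℂ → ℝ} {f : ℂ → ℂ} {U : Set ℂ} {c : ℂ} {R p : ℝ}

theorem log_norm_le_circleAverage (hR : 0 < R) (hf : AnalyticOnNhd ℂ f (closedBall c R))
    (hfc : f c ≠ 0) : Real.log ‖f c‖ ≤ Real.circleAverage (Real.log ‖f ·‖) c R := by
  have hR' : |R| = R := abs_of_pos hR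
  rw [AnalyticOnNhd.circleAverage_log_norm hR.ne' (by rwa [hR']) hfc, hR']
  refine le_add_of_nonneg_left (finsum_nonneg fun u => ?_)
  by_cases hu : u ∈ closedBall c R
  · refine mul_nonneg ?_ ?_
    · exact_mod_cast (MeromorphicOn.AnalyticOnNhd.divisor_nonneg hf) u
    · rcases eq_or_ne c u with rfl | hcu
      · simp
      · have h0 : 0 < ‖c - u‖ := norm_pos_iff.2 (sub_ne_zero.2 hcu)
        refine Real.log_nonneg ?_
        rw [← div_eq_mul_inv, one_le_div h0, ← dist_eq_norm, dist_comm]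
        exact hu
  · rw [Function.locallyFinsuppWithin.apply_eq_zero_of_notMem _ hu]
    simp

theorem continuousOn_norm_rpow_mul_exp (hp : 0 < p) (hf : ContinuousOn f U)
    (hφ : ContinuousOn φ U) :
    ContinuousOn (fun z => ‖f z‖ ^ p * Real.exp (p * φ z)) U :=
  (hf.norm.rpow_const fun _ _ => Or.inr hp.le).mul (continuousOn_const.mul hφ).rexp

theorem norm_rpow_mul_exp_le_circleAverage (hp : 0 < p) (hU : IsOpen U)
    (hφ : ContDiffOn ℝ 2 φ U) (hlap : ∀ z ∈ U, 0 ≤ lap φ z) (hf : DifferentiableOn ℂ f U)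
    (hcR : closedBall c R ⊆ U) (hR : 0 < R) :
    ‖f c‖ ^ p * Real.exp (p * φ c) ≤
      Real.circleAverage (fun z => ‖f z‖ ^ p * Real.exp (p * φ z)) c R := by
  have hR' : |R| = R := abs_of_pos hR
  by_cases hfc : f c = 0
  · rw [hfc, norm_zero, Real.zero_rpow hp.ne', zero_mul]
    exact Real.circleAverage_nonneg_of_nonneg fun z _ => by positivity
  have hsph : sphere c R ⊆ U := sphere_subset_closedBall.trans hcR
  have han : AnalyticOnNhd ℂ f (closedBall c R) := (hf.analyticOnNhd hU).mono hcR
  have hexp : ∀ z, f z ≠ 0 → ‖f z‖ ^ p * Real.exp (p * φ z) =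
      Real.exp (p * Real.log ‖f z‖ + p * φ z) := fun z hz => by
    rw [Real.exp_add, Real.rpow_def_of_pos (norm_pos_iff.2 hz), mul_comm (Real.log _)]
  have hlogint : CircleIntegrable (fun z => Real.log ‖f z‖) c R :=
    MeromorphicOn.circleIntegrable_log_norm (by
      rw [hR']; exact (han.mono sphere_subset_closedBall).meromorphicOn)
  have hφint : CircleIntegrable φ c R :=
    (hφ.continuousOn.mono hsph).circleIntegrable hR.le
  have hVint : CircleIntegrable (fun z => ‖f z‖ ^ p * Real.exp (p * φ z)) c R :=
    ((continuousOn_norm_rpow_mul_exp hp hf.continuousOn hφ.continuousOn).mono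
      hsph).circleIntegrable hR.le
  set a := p * Real.log ‖f c‖ + p * φ c with ha
  have hcod : (fun z => ‖f z‖ ^ p * Real.exp (p * φ z)) =ᶠ[Filter.codiscreteWithin (sphere c |R|)]
      fun z => max (‖f z‖ ^ p * Real.exp (p * φ z))
        (Real.exp a * (1 - a) + (Real.exp a * p) • (Real.log ‖f z‖ + φ z)) := by
    have hnz := han.preimage_zero_mem_codiscreteWithin (x := c) hfc
      (mem_closedBall_self hR.le)
      ((convex_closedBall c R).isConnected ⟨c, mem_closedBall_self hR.le⟩)
    rw [hR']
    filter_upwards [Filter.codiscreteWithin_mono sphere_subset_closedBall hnz] with z hz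
    have hz : f z ≠ 0 := hz
    rw [hexp z hz, eq_comm, max_eq_left]
    have h := mul_le_mul_of_nonneg_left
      (Real.add_one_le_exp (p * Real.log ‖f z‖ + p * φ z - a)) (Real.exp_pos a).le
    rw [← Real.exp_add, add_sub_cancel] at h
    rw [smul_eq_mul]
    linarith
  have hsint : CircleIntegrable
      (fun z => (Real.exp a * p) • (Real.log ‖f z‖ + φ z)) c R :=
    (hlogint.add hφint).const_smul
  have hLint : CircleIntegrable
      (fun z => Real.exp a * (1 - a) + (Real.exp a * p) • (Real.log ‖f z‖ + φ z)) c R :=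
    (circleIntegrable_const _ c R).add hsint
  rw [Real.circleAverage_congr_codiscreteWithin hcod hR.ne', hexp c hfc]
  have hmaxint : CircleIntegrable (fun z => max (‖f z‖ ^ p * Real.exp (p * φ z))
        (Real.exp a * (1 - a) + (Real.exp a * p) • (Real.log ‖f z‖ + φ z))) c R :=
    ⟨hVint.1.sup hLint.1, hVint.2.sup hLint.2⟩
  refine le_trans ?_ (Real.circleAverage_mono hLint hmaxint fun z _ => le_max_right _ _)
  rw [Real.circleAverage_fun_add (circleIntegrable_const _ c R) hsint,
    Real.circleAverage_const, Real.circleAverage_fun_smul,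
    Real.circleAverage_fun_add hlogint hφint, smul_eq_mul]
  have h1 := log_norm_le_circleAverage hR han hfc
  have h2 := le_circleAverage_of_lap_nonneg hU hφ hlap hcR hR
  have h3 : a ≤ p * (Real.circleAverage (Real.log ‖f ·‖) c R + Real.circleAverage φ c R) := by
    rw [ha, ← mul_add]
    gcongr
  have h4 := mul_le_mul_of_nonneg_left h3 (Real.exp_pos a).le
  linarith

end SubMean

/-- A continuous function satisfying the sub-mean value inequality on small circles attains its
maximum over a closed ball on the boundary sphere. -/
theorem exists_mem_sphere_forall_le {V : ℂ → ℝ} {U : Set ℂ} {r : ℝ} (hr : 0 < r)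
    (hV : ContinuousOn V U) (hrU : closedBall (0 : ℂ) r ⊆ U)
    (hsub : ∀ c R, 0 < R → closedBall c R ⊆ U → V c ≤ Real.circleAverage V c R) :
    ∃ z₀ ∈ sphere (0 : ℂ) r, ∀ z ∈ closedBall (0 : ℂ) r, V z ≤ V z₀ := by
  have hVr := hV.mono hrU
  have hcpt := isCompact_closedBall (0 : ℂ) r
  obtain ⟨x, hx, hxmax⟩ := hcpt.exists_isMaxOn ⟨0, mem_closedBall_self hr.le⟩ hVr
  have hM : IsCompact (closedBall (0 : ℂ) r ∩ V ⁻¹' {V x}) :=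
    hcpt.of_isClosed_subset (hVr.preimage_isClosed_of_isClosed isClosed_closedBall
      isClosed_singleton) inter_subset_left
  obtain ⟨y, ⟨hy, hyx⟩, hymax⟩ := hM.exists_isMaxOn ⟨x, hx, rfl⟩ continuous_norm.continuousOn
  have hyx : V y = V x := hyx
  refine ⟨y, ?_, fun z hz => hyx ▸ hxmax hz⟩
  by_contra hys
  have hyr : ‖y‖ < r := lt_of_le_of_ne (by simpa using hy) (by simpa using hys)
  set R := r - ‖y‖ with hR
  have hR0 : 0 < R := sub_pos.2 hyr
  have hball : closedBall y R ⊆ closedBall 0 r :=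
    closedBall_subset_closedBall' (by simp [hR])
  have hmem : ∀ θ, circleMap y R θ ∈ closedBall (0 : ℂ) r := fun θ =>
    hball (circleMap_mem_closedBall y hR0.le θ)
  have hθ : ∃ θ ∈ Icc 0 (2 * Real.pi), V (circleMap y R θ) < V x := by
    obtain ⟨w, hw, hwy⟩ : ∃ w ∈ sphere y R, ‖y‖ < ‖w‖ := by
      rcases eq_or_ne y 0 with rfl | hy0
      · exact ⟨R, by simp [abs_of_pos hR0], by simpa using hR0.ne'⟩
      · have hyn : 0 < ‖y‖ := norm_pos_iff.2 hy0
        refine ⟨y + (R / ‖y‖) • y, ?_, ?_⟩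
        · simp [abs_of_pos hR0, hyn.ne']
        · have : y + (R / ‖y‖) • y = (1 + R / ‖y‖) • y := by rw [add_smul, one_smul]
          rw [this, norm_smul, Real.norm_of_nonneg (by positivity), add_mul, one_mul,
            div_mul_cancel₀ _ hyn.ne']
          linarith
    have hw' := hw
    rw [← abs_of_pos hR0, ← image_circleMap_Ioc] at hw'
    obtain ⟨θ, hθ, rfl⟩ := hw'
    refine ⟨θ, Ioc_subset_Icc_self hθ, lt_of_le_of_ne (hxmax (hmem θ)) fun h => ?_⟩
    exact absurd (hymax ⟨hmem θ, h⟩) (not_le.2 hwy)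
  have hlt := intervalIntegral.integral_lt_integral_of_continuousOn_of_le_of_exists_lt
    Real.two_pi_pos (hVr.comp (continuous_circleMap y R).continuousOn fun θ _ => hmem θ)
    continuousOn_const (fun θ _ => hxmax (hmem θ)) hθ
  have h := hsub y R hR0 (hball.trans hrU)
  rw [Real.circleAverage, smul_eq_mul, inv_mul_eq_div, le_div_iff₀ Real.two_pi_pos, hyx] at h
  simp at hlt
  linarith

theorem circleAverage_eq_integral_neg_pi_pi (V : ℂ → ℝ) (c : ℂ) (r : ℝ) :
    Real.circleAverage V c r =
      (2 * Real.pi)⁻¹ * ∫ θ in -Real.pi..Real.pi, V (circleMap c r θ) := by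
  rw [Real.circleAverage_eq_integral_add (-Real.pi), smul_eq_mul,
    intervalIntegral.integral_comp_add_right (fun θ => V (circleMap c r θ))]
  congr 3 <;> ring

/-- The sub-mean value inequality on circles gives, up to a factor, the one on disks. -/
theorem ofReal_mul_le_lintegral_ball {V : ℂ → ℝ} {c : ℂ} {R : ℝ} (hR : 0 < R)
    (hV : ContinuousOn V (closedBall c R)) (hV0 : ∀ z, 0 ≤ V z)
    (hsub : ∀ r, 0 < r → r ≤ R → V c ≤ Real.circleAverage V c r) :
    ENNReal.ofReal (Real.pi * R ^ 2 / 2 * V c) ≤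
      ∫⁻ z in ball c R, ENNReal.ofReal (V z) := by
  have hπ := Real.pi_pos
  set S : Set (ℝ × ℝ) := Ioo (R / 2) R ×ˢ Ioo (-Real.pi) Real.pi with hS
  have hSm : MeasurableSet S := measurableSet_Ioo.prod measurableSet_Ioo
  have hSt : S ⊆ polarCoord.target :=
    prod_mono (fun r hr => (half_pos hR).trans hr.1) Subset.rfl
  have hcont : ContinuousOn
      (fun x : ℝ × ℝ => ENNReal.ofReal (x.1 * V (circleMap c x.1 x.2))) S := by
    refine ENNReal.continuous_ofReal.comp_continuousOn (continuousOn_fst.mul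
      (hV.comp (continuous_circleMap_prod c).continuousOn fun x hx => ?_))
    exact closedBall_subset_closedBall hx.1.2.le
      (circleMap_mem_closedBall c ((half_pos hR).trans hx.1.1).le x.2)
  have hpolar : ∫⁻ x in S, ENNReal.ofReal (x.1 * V (circleMap c x.1 x.2)) ≤
      ∫⁻ z in ball c R, ENNReal.ofReal (V z) := by
    rw [← lintegral_indicator measurableSet_ball, ← lintegral_add_left_eq_self _ c,
      ← Complex.lintegral_comp_polarCoord_symm]
    refine le_trans (setLIntegral_mono' hSm fun x hx => ?_) (lintegral_mono_set hSt)
    have hx0 : 0 < x.1 := (half_pos hR).trans hx.1.1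
    have hmap : c + Complex.polarCoord.symm x = circleMap c x.1 x.2 := by
      rw [Complex.polarCoord_symm_apply, circleMap, Complex.exp_mul_I, Complex.ofReal_cos,
        Complex.ofReal_sin]
    have hmem : circleMap c x.1 x.2 ∈ ball c R := by
      rw [mem_ball, dist_eq_norm]
      simpa [circleMap, abs_of_pos hx0] using hx.1.2
    rw [hmap, indicator_of_mem hmem, smul_eq_mul, ENNReal.ofReal_mul hx0.le]
  refine le_trans ?_ hpolar
  rw [Measure.volume_eq_prod, hS, ← Measure.prod_restrict, lintegral_prod]
  · have hinner : ∀ r ∈ Ioo (R / 2) R, ENNReal.ofReal (Real.pi * R * V c) ≤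
        ∫⁻ θ in Ioo (-Real.pi) Real.pi, ENNReal.ofReal (r * V (circleMap c r θ)) := by
      intro r hr
      have hr0 : 0 < r := (half_pos hR).trans hr.1
      have hc : ContinuousOn (fun θ => r * V (circleMap c r θ)) (Icc (-Real.pi) Real.pi) :=
        continuousOn_const.mul (hV.comp (continuous_circleMap c r).continuousOn fun θ _ =>
          closedBall_subset_closedBall hr.2.le (circleMap_mem_closedBall c hr0.le θ))
      rw [← ofReal_integral_eq_lintegral_ofReal
        (hc.integrableOn_Icc.mono_set Ioo_subset_Icc_self)
        (ae_of_all _ fun θ => mul_nonneg hr0.le (hV0 _)), ← integral_Ioc_eq_integral_Ioo,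
        ← intervalIntegral.integral_of_le (by linarith), intervalIntegral.integral_const_mul]
      have h := hsub r hr0 hr.2.le
      rw [circleAverage_eq_integral_neg_pi_pi, inv_mul_eq_div,
        le_div_iff₀ Real.two_pi_pos] at h
      refine ENNReal.ofReal_le_ofReal ?_
      calc Real.pi * R * V c = R / 2 * (V c * (2 * Real.pi)) := by ring
        _ ≤ r * ∫ θ in -Real.pi..Real.pi, V (circleMap c r θ) :=
          mul_le_mul hr.1.le h (mul_nonneg (hV0 c) Real.two_pi_pos.le) hr0.le
    refine le_trans ?_ (setLIntegral_mono' measurableSet_Ioo hinner)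
    rw [setLIntegral_const, Real.volume_Ioo, ← ENNReal.ofReal_mul (by have := hV0 c; positivity)]
    refine ENNReal.ofReal_le_ofReal (le_of_eq ?_)
    ring
  · rw [Measure.prod_restrict, ← Measure.volume_eq_prod]
    exact hcont.aemeasurable hSm

theorem lap_const_mul_norm_sq_sub {ψ : ℂ → ℝ} {U : Set ℂ} (hU : IsOpen U)
    (hψ : ContDiffOn ℝ 2 ψ U) (a : ℝ) {z : ℂ} (hz : z ∈ U) :
    lap (fun w => a * ‖w‖ ^ 2 - ψ w) z = 4 * a - lap ψ z := by
  have h1 : fderiv ℝ (fun w => a * ‖w‖ ^ 2 - ψ w) =ᶠ[𝓝 z]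
      fun w => (a • (2 : ℝ) • innerSL ℝ (E := ℂ)) w - fderiv ℝ ψ w := by
    filter_upwards [hU.mem_nhds hz] with w hw
    have hψw := (hψ.differentiableOn two_ne_zero).differentiableAt (hU.mem_nhds hw)
    have hn : DifferentiableAt ℝ (fun w : ℂ => ‖w‖ ^ 2) w :=
      differentiableAt_id.norm_sq ℝ
    rw [fderiv_fun_sub (hn.const_mul a) hψw, fderiv_const_mul hn, fderiv_norm_sq]
    ext
    simp [-mul_eq_mul_left_iff]
    ring
  rw [lap, h1.fderiv_eq, fderiv_fun_sub (ContinuousLinearMap.differentiableAt _)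
    (hasFDerivAt_fderiv hU hψ hz).differentiableAt, ContinuousLinearMap.fderiv, lap]
  have h2 : innerSL ℝ (1 : ℂ) 1 = 1 := by simp
  have h3 : innerSL ℝ Complex.I Complex.I = 1 := by simp
  simp only [sub_apply, smul_apply, smul_eq_mul]
  linear_combination (2 * a) * (h2 + h3)

theorem measurableSet_annulus : MeasurableSet {z : ℂ | 1 / 2 < ‖z‖ ∧ ‖z‖ < 1} :=
  ((isOpen_lt continuous_const continuous_norm).inter
    (isOpen_lt continuous_norm continuous_const)).measurableSet

/-- **Lemma (inner–outer estimate on the disk).**  For every `K > 0` and `p ∈ (0,∞)`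
there is `C > 0`, depending only on `K` and `p`, such that for every `C²` subharmonic
`ψ` on the unit disk with `Δψ ≤ K` and every holomorphic `f` on the disk,
`∫_{|z|<1} |f|^p e^{-pψ} ≤ C ∫_{1/2<|z|<1} |f|^p e^{-pψ}` (in `[0,∞]`). -/
theorem disk_annulus_estimate (K : ℝ) (hK : 0 < K) (p : ℝ) (hp : 0 < p) :
    ∃ C > (0 : ℝ), ∀ ψ : ℂ → ℝ, ContDiffOn ℝ 2 ψ (Metric.ball 0 1) →
      (∀ z ∈ Metric.ball (0 : ℂ) 1, 0 ≤ lap ψ z ∧ lap ψ z ≤ K) →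
      ∀ f : ℂ → ℂ, DifferentiableOn ℂ f (Metric.ball 0 1) →
        ∫⁻ z in Metric.ball (0 : ℂ) 1,
            ENNReal.ofReal (‖f z‖ ^ p * Real.exp (-(p * ψ z))) ≤
          ENNReal.ofReal C *
            ∫⁻ z in {z : ℂ | 1 / 2 < ‖z‖ ∧ ‖z‖ < 1},
              ENNReal.ofReal (‖f z‖ ^ p * Real.exp (-(p * ψ z))) := by
  refine ⟨1 + 128 * Real.exp (p * (K / 4)), by positivity, fun ψ hψ hlap f hf => ?_⟩
  set A := {z : ℂ | 1 / 2 < ‖z‖ ∧ ‖z‖ < 1}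
  set v : ℂ → ℝ := fun z => ‖f z‖ ^ p * Real.exp (-(p * ψ z)) with hv
  set φ : ℂ → ℝ := fun z => K / 4 * ‖z‖ ^ 2 - ψ z with hφ
  set V : ℂ → ℝ := fun z => ‖f z‖ ^ p * Real.exp (p * φ z) with hVdef
  have hVv : ∀ z, V z = Real.exp (p * (K / 4 * ‖z‖ ^ 2)) * v z := fun z => by
    simp only [hVdef, hv, hφ]
    rw [mul_left_comm, ← Real.exp_add]
    ring_nf
  have hv0 : ∀ z, 0 ≤ v z := fun z => by positivity
  have hV0 : ∀ z, 0 ≤ V z := fun z => by positivity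
  have hvV : ∀ z, v z ≤ V z := fun z => by
    rw [hVv]
    exact le_mul_of_one_le_left (hv0 z) (Real.one_le_exp (by positivity))
  have hVle : ∀ z ∈ A, V z ≤ Real.exp (p * (K / 4)) * v z := fun z hz => by
    rw [hVv]
    have : ‖z‖ ^ 2 ≤ 1 := pow_le_one₀ (norm_nonneg z) hz.2.le
    refine mul_le_mul_of_nonneg_right ?_ (hv0 z)
    gcongr
    exact mul_le_of_le_one_right (by positivity) this
  have hφ2 : ContDiffOn ℝ 2 φ (ball 0 1) :=
    ((contDiff_norm_sq ℝ).contDiffOn.const_smul (K / 4)).sub hψ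
  have hφlap : ∀ z ∈ ball (0 : ℂ) 1, 0 ≤ lap φ z := fun z hz => by
    rw [hφ, lap_const_mul_norm_sq_sub isOpen_ball hψ _ hz]
    linarith [(hlap z hz).2]
  have hVc : ContinuousOn V (ball 0 1) :=
    continuousOn_norm_rpow_mul_exp hp hf.continuousOn hφ2.continuousOn
  have hsub : ∀ c R, 0 < R → closedBall c R ⊆ ball (0 : ℂ) 1 →
      V c ≤ Real.circleAverage V c R := fun c R hR hcR =>
    norm_rpow_mul_exp_le_circleAverage hp isOpen_ball hφ2 hφlap hf hcR hR
  obtain ⟨z₀, hz₀, hmax⟩ := exists_mem_sphere_forall_le (r := 3 / 4) (by norm_num) hVc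
    (closedBall_subset_ball (by norm_num)) hsub
  have hz₀n : ‖z₀‖ = 3 / 4 := by simpa using hz₀
  have hcb : closedBall z₀ (1 / 8) ⊆ A := fun z hz => by
    rw [mem_closedBall, dist_eq_norm] at hz
    have h1 := abs_norm_sub_norm_le z z₀
    rw [abs_le, hz₀n] at h1
    constructor <;> linarith
  have hAb : A ⊆ ball 0 1 := fun z hz => by simpa using hz.2
  have hmean : ENNReal.ofReal (Real.pi * (1 / 8) ^ 2 / 2 * V z₀) ≤
      ENNReal.ofReal (Real.exp (p * (K / 4))) * ∫⁻ z in A, ENNReal.ofReal (v z) := by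
    calc _ ≤ ∫⁻ z in ball z₀ (1 / 8), ENNReal.ofReal (V z) :=
          ofReal_mul_le_lintegral_ball (by norm_num) (hVc.mono (hcb.trans hAb)) hV0
            fun r hr hr8 => hsub z₀ r hr
              ((closedBall_subset_closedBall hr8).trans (hcb.trans hAb))
      _ ≤ ∫⁻ z in A, ENNReal.ofReal (V z) :=
          lintegral_mono_set (ball_subset_closedBall.trans hcb)
      _ ≤ ∫⁻ z in A, ENNReal.ofReal (Real.exp (p * (K / 4))) * ENNReal.ofReal (v z) :=
          setLIntegral_mono' measurableSet_annulus fun z hz => by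
            rw [← ENNReal.ofReal_mul (Real.exp_pos _).le]
            exact ENNReal.ofReal_le_ofReal (hVle z hz)
      _ = _ := lintegral_const_mul' _ _ ENNReal.ofReal_ne_top
  have hinner : ∫⁻ z in closedBall (0 : ℂ) (1 / 2), ENNReal.ofReal (v z) ≤
      ENNReal.ofReal (128 * Real.exp (p * (K / 4))) * ∫⁻ z in A, ENNReal.ofReal (v z) := by
    calc _ ≤ ∫⁻ z in closedBall (0 : ℂ) (1 / 2), ENNReal.ofReal (V z₀) :=
          setLIntegral_mono' measurableSet_closedBall fun z hz =>
            ENNReal.ofReal_le_ofReal ((hvV z).trans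
              (hmax z (closedBall_subset_closedBall (by norm_num) hz)))
      _ = ENNReal.ofReal (Real.pi / 4 * V z₀) := by
          have hvol : volume (closedBall (0 : ℂ) (1 / 2)) = ENNReal.ofReal (Real.pi / 4) := by
            rw [Complex.volume_closedBall, ← ENNReal.ofReal_coe_nnreal, NNReal.coe_real_pi,
              ← ENNReal.ofReal_pow (by norm_num), ← ENNReal.ofReal_mul (by norm_num)]
            congr 1
            ring
          rw [setLIntegral_const, hvol, ← ENNReal.ofReal_mul (hV0 z₀), mul_comm]
      _ ≤ ENNReal.ofReal (128 * (Real.pi * (1 / 8) ^ 2 / 2 * V z₀)) :=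
          ENNReal.ofReal_le_ofReal (by nlinarith [mul_nonneg Real.pi_pos.le (hV0 z₀)])
      _ ≤ _ := by
          rw [ENNReal.ofReal_mul (p := 128) (by norm_num),
            ENNReal.ofReal_mul (p := 128) (by norm_num), mul_assoc]
          gcongr
  calc _ ≤ ∫⁻ z in A ∪ closedBall (0 : ℂ) (1 / 2), ENNReal.ofReal (v z) :=
        lintegral_mono_set fun z hz => by
          rcases lt_or_ge (1 / 2) ‖z‖ with h | h
          · exact Or.inl ⟨h, by simpa using hz⟩
          · exact Or.inr (by simpa using h)
    _ ≤ (∫⁻ z in A, ENNReal.ofReal (v z)) +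
          ∫⁻ z in closedBall (0 : ℂ) (1 / 2), ENNReal.ofReal (v z) :=
        lintegral_union_le _ _ _
    _ ≤ _ := by
        rw [ENNReal.ofReal_add zero_le_one (by positivity), ENNReal.ofReal_one, add_mul, one_mul]
        gcongr
end
end

section
/- Let φ : ℂⁿ → ℝ be a C² plurisubharmonic function with cω ≤ i∂∂̄φ ≤ Cω for some constants 0 < c ≤ C, and let W ⊂ ℂⁿ be a uniformly flat smooth closed complex hypersurface that is a sampling hypersurface for BF^∞_φ(ℂⁿ). Then there exists a uniformly separated sequence Σ ⊂ W that is a sampling sequence for BF^∞_φ(ℂⁿ). -/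
open MeasureTheory Metric Set
open scoped ENNReal NNReal Topology

noncomputable section

/-- `ℂⁿ` with the Euclidean (Hermitian) norm. -/
abbrev En (n : ℕ) : Type := EuclideanSpace ℂ (Fin n)

instance (n : ℕ) : MeasurableSpace (En n) := borel _
instance (n : ℕ) : BorelSpace (En n) := ⟨rfl⟩

/-- Lebesgue measure on `ℂⁿ ≅ ℝ^{2n}`, realized as `2n`-dimensional Hausdorff measure. -/
def vol (n : ℕ) : Measure (En n) := μH[(2 * n : ℝ)]

/-- The surface measure `dσ` on a hypersurface `W` induced by `ω^{n-1}`: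
a constant multiple of `(2n-2)`-dimensional Hausdorff measure restricted to `W`. -/
def surf (n : ℕ) (W : Set (En n)) : Measure (En n) :=
  ((2 : ℝ≥0∞) ^ (n - 1) * (Nat.factorial (n - 1) : ℝ≥0∞)) •
    (μH[(2 * n - 2 : ℝ)] : Measure (En n)).restrict W

open Classical in
/-- The weighted `L^p`-"norm" (to the `p`-th power for `p < ∞`) of `F` over the set `S`
with respect to the measure `μ` and the weight `φ`; for `p = ∞` it is the weighted sup. -/
def wNorm {n : ℕ} (p : ℝ≥0∞) (φ : En n → ℝ) (μ : Measure (En n)) (S : Set (En n))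
    (F : En n → ℂ) : ℝ≥0∞ :=
  if p = ⊤ then ⨆ z ∈ S, ENNReal.ofReal (‖F z‖ * Real.exp (-φ z))
  else ∫⁻ z in S, ENNReal.ofReal (‖F z‖ ^ p.toReal * Real.exp (-(p.toReal * φ z))) ∂μ

/-- Real Hessian of `φ` at `z` in the directions `u`, `v`. -/
def hess {n : ℕ} (φ : En n → ℝ) (z u v : En n) : ℝ := fderiv ℝ (fderiv ℝ φ) z u v

/-- The Levi form `i∂∂̄φ(z)(v,v̄) = Σ φ_{j k̄}(z) v_j v̄_k`, expressed through the
real Hessian.  For `φ = ‖z‖²` it equals `‖v‖²`, i.e. `ω = i∂∂̄‖z‖²` corresponds to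
`levi = ‖v‖²`. -/
def levi {n : ℕ} (φ : En n → ℝ) (z v : En n) : ℝ :=
  (hess φ z v v + hess φ z (Complex.I • v) (Complex.I • v)) / 4

/-- `W` is uniformly flat with tubular radius `ε₀`: the neighborhood
`N_{ε₀}(W)` is a tubular neighborhood, i.e. every point of it has a unique nearest
point on `W` and the (smooth) nearest-point projection `pr` is well defined there. -/
def UniformlyFlatWith {n : ℕ} (ε₀ : ℝ) (W : Set (En n)) : Prop :=
  0 < ε₀ ∧ ∃ pr : En n → En n,
    ContDiffOn ℝ (⊤ : ℕ∞) pr {z | Metric.infDist z W < ε₀} ∧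
    ∀ z : En n, Metric.infDist z W < ε₀ →
      pr z ∈ W ∧ dist z (pr z) = Metric.infDist z W ∧
        ∀ w ∈ W, dist z w = Metric.infDist z W → w = pr z

/-- `W` is uniformly flat. -/
def UniformlyFlat {n : ℕ} (W : Set (En n)) : Prop := ∃ ε₀, UniformlyFlatWith ε₀ W

/-- `f` is holomorphic on the complex submanifold `W`: near every point of `W` it is
the restriction of some holomorphic function of the ambient space. -/
def HolOn {n : ℕ} (W : Set (En n)) (f : En n → ℂ) : Prop :=
  ∀ w ∈ W, ∃ U ∈ 𝓝 w, ∃ g : En n → ℂ, DifferentiableOn ℂ g U ∧ Set.EqOn f g (U ∩ W)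

/-- The average `φ_r` of `φ` over the ball `B(z,r)`. -/
def avgBall {n : ℕ} (φ : En n → ℝ) (r : ℝ) (z : En n) : ℝ :=
  ((vol n) (Metric.ball z r)).toReal⁻¹ * ∫ x in Metric.ball z r, φ x ∂(vol n)

/-- The averaged current of integration `Υ_W(z,r)(v,v̄)`: by Lelong–Poincaré,
`Υ_W(z,r)(v,v) = (π / vol B(z,r)) ∫_{W ∩ B(z,r)} |⟨v, n_w⟩|² dσ(w)`, where the unit
normal pairing is `|⟨v, n_w⟩| = ‖dT_w(v)‖ / ‖dT_w‖` for a defining function `T` of `W`. -/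
def Upsilon {n : ℕ} (T : En n → ℂ) (W : Set (En n)) (r : ℝ) (z v : En n) : ℝ :=
  (Real.pi / ((vol n) (Metric.ball z r)).toReal) *
    ∫ w in Metric.ball z r, (‖fderiv ℂ T w v‖ / ‖fderiv ℂ T w‖) ^ 2 ∂(surf n W)

/-- A set of points of `ℂⁿ` is uniformly separated if distinct points are at least a
fixed positive distance apart. -/
def UnifSep {n : ℕ} (S : Set (En n)) : Prop :=
  ∃ δ > (0 : ℝ), ∀ x ∈ S, ∀ y ∈ S, x ≠ y → δ ≤ dist x y

section

open InnerProductSpace Laplacian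

lemma deriv_deriv_nonpos_of_isLocalMax {g : ℝ → ℝ} {a : ℝ} (h : IsLocalMax g a)
    (hc : ContinuousAt g a) : deriv (deriv g) a ≤ 0 := by
  by_contra! hpos
  have hmin : IsLocalMin g a := isLocalMin_of_deriv_deriv_pos hpos h.deriv_eq_zero hc
  have hconst : g =ᶠ[𝓝 a] fun _ => g a := by
    filter_upwards [h, hmin] with x hx hx'
    exact le_antisymm hx hx'
  have := hconst.deriv.deriv_eq
  simp at this
  linarith

lemma deriv_deriv_line {E : Type*} [NormedAddCommGroup E] [NormedSpace ℝ E] {u : E → ℝ}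
    (hu : ContDiff ℝ 2 u) (z e : E) :
    deriv (deriv fun t : ℝ => u (z + t • e)) 0 = fderiv ℝ (fderiv ℝ u) z e e := by
  have hline (t : ℝ) : HasDerivAt (fun t : ℝ => z + t • e) e t := by
    simpa using ((hasDerivAt_id t).smul_const e).const_add z
  have h1 : (deriv fun t : ℝ => u (z + t • e)) = fun t => fderiv ℝ u (z + t • e) e := by
    funext t
    exact (((hu.differentiable (by norm_num)) _).hasFDerivAt.comp_hasDerivAt t (hline t)).deriv
  have hd : Differentiable ℝ (fderiv ℝ u) :=
    (hu.fderiv_right (m := 1) (by norm_num)).differentiable (by norm_num)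
  have h2 : HasDerivAt (fun t : ℝ => fderiv ℝ u (z + t • e)) (fderiv ℝ (fderiv ℝ u) z e) 0 := by
    have h3 : HasFDerivAt (fderiv ℝ u) (fderiv ℝ (fderiv ℝ u) z) (z + (0 : ℝ) • e) := by
      simpa only [zero_smul, add_zero] using (hd z).hasFDerivAt
    exact h3.comp_hasDerivAt 0 (hline 0)
  have h4 : HasDerivAt (fun t : ℝ => fderiv ℝ u (z + t • e) e) (fderiv ℝ (fderiv ℝ u) z e e) 0 :=
    (ContinuousLinearMap.apply ℝ ℝ e).hasFDerivAt.comp_hasDerivAt 0 h2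
  rw [h1]
  exact h4.deriv

lemma fderiv_fderiv_nonpos_of_isLocalMax {E : Type*} [NormedAddCommGroup E] [NormedSpace ℝ E]
    {u : E → ℝ} (hu : ContDiff ℝ 2 u) {z : E} (h : IsLocalMax u z) (e : E) :
    fderiv ℝ (fderiv ℝ u) z e e ≤ 0 := by
  rw [← deriv_deriv_line hu]
  have hcont : Continuous fun t : ℝ => z + t • e := by fun_prop
  refine deriv_deriv_nonpos_of_isLocalMax ?_ (hu.continuous.comp hcont).continuousAt
  have ht : Filter.Tendsto (fun t : ℝ => z + t • e) (𝓝 0) (𝓝 z) := by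
    simpa using hcont.tendsto 0
  have := ht.eventually h
  simpa [IsLocalMax, IsMaxFilter] using this

lemma laplacian_complex_eq (u : ℂ → ℝ) (z : ℂ) :
    (Δ u) z = fderiv ℝ (fderiv ℝ u) z 1 1 + fderiv ℝ (fderiv ℝ u) z Complex.I Complex.I := by
  simp [laplacian_eq_iteratedFDeriv_complexPlane, iteratedFDeriv_two_apply]

lemma laplacian_norm_sq (z : ℂ) : (Δ fun w : ℂ => ‖w‖ ^ 2) z = 4 := by
  have h1 : (fderiv ℝ fun w : ℂ => ‖w‖ ^ 2) = fun w => (2 • innerSL ℝ : ℂ →L[ℝ] ℂ →L[ℝ] ℝ) w := by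
    funext w
    exact (hasStrictFDerivAt_norm_sq w).hasFDerivAt.fderiv
  have h2 (e : ℂ) : (2 • innerSL ℝ : ℂ →L[ℝ] ℂ →L[ℝ] ℝ) e e = 2 * ‖e‖ ^ 2 := by
    rw [← real_inner_self_eq_norm_sq e, two_mul, two_smul]
    rfl
  rw [laplacian_complex_eq, h1, ContinuousLinearMap.fderiv, h2, h2]
  norm_num

lemma contDiff_norm_sq_complex : ContDiff ℝ 2 fun w : ℂ => ‖w‖ ^ 2 := contDiff_norm_sq ℝ

lemma le_of_laplacian_pos {u : ℂ → ℝ} (hu : ContDiff ℝ 2 u) (hpos : ∀ z, 0 < (Δ u) z) {m : ℝ}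
    (hm : ∀ z, ‖z‖ = 1 → u z ≤ m) {z : ℂ} (hz : ‖z‖ ≤ 1) : u z ≤ m := by
  obtain ⟨x, hx, hmax⟩ := (isCompact_closedBall (0 : ℂ) 1).exists_isMaxOn
    (nonempty_closedBall.2 zero_le_one) hu.continuous.continuousOn
  have hzx : u z ≤ u x := hmax (by simpa using hz)
  refine hzx.trans ?_
  rcases (show ‖x‖ ≤ 1 by simpa using hx).lt_or_eq with hlt | heq
  · have hloc : IsLocalMax u x := hmax.isLocalMax
      (Filter.mem_of_superset (isOpen_ball.mem_nhds (by simpa using hlt)) ball_subset_closedBall)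
    have h := hpos x
    rw [laplacian_complex_eq] at h
    have h1 := fderiv_fderiv_nonpos_of_isLocalMax hu hloc 1
    have h2 := fderiv_fderiv_nonpos_of_isLocalMax hu hloc Complex.I
    linarith
  · exact hm x heq

/-- The weak maximum principle for `C²` subharmonic functions on the unit disc. -/
lemma le_of_laplacian_nonneg {u : ℂ → ℝ} (hu : ContDiff ℝ 2 u) (hnn : ∀ z, 0 ≤ (Δ u) z) {m : ℝ}
    (hm : ∀ z, ‖z‖ = 1 → u z ≤ m) {z : ℂ} (hz : ‖z‖ ≤ 1) : u z ≤ m := by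
  refine le_of_forall_pos_le_add fun ε hε => ?_
  have hq : ContDiff ℝ 2 (ε • fun w : ℂ => ‖w‖ ^ 2) := contDiff_norm_sq_complex.const_smul ε
  have key := le_of_laplacian_pos (u := u + ε • fun w : ℂ => ‖w‖ ^ 2) (hu.add hq)
    (fun w => by
      rw [hu.contDiffAt.laplacian_add hq.contDiffAt,
        laplacian_smul _ contDiff_norm_sq_complex.contDiffAt, laplacian_norm_sq]
      have := hnn w
      simp only [smul_eq_mul]
      linarith) (m := m + ε)
    (fun w hw => by
      have := hm w hw
      simp [hw, this]) hz
  simp only [Pi.add_apply, Pi.smul_apply, smul_eq_mul] at key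
  have : 0 ≤ ε * ‖z‖ ^ 2 := by positivity
  linarith

lemma laplacian_re_eq_zero {P : ℂ → ℂ} (hP : Differentiable ℂ P) (z : ℂ) :
    (Δ fun w => (P w).re) z = 0 :=
  (((hP.analyticAt z).harmonicAt_re).2).eq_of_nhds

lemma contDiff_re {P : ℂ → ℂ} (hP : Differentiable ℂ P) : ContDiff ℝ 2 fun w => (P w).re :=
  Complex.reCLM.contDiff.comp (hP.contDiff.restrict_scalars ℝ)

/-- Trigonometric polynomials are boundary values of sums of an entire function and the conjugate
of an entire function. -/
lemma exists_entire_of_mem_span_fourier {q : C(AddCircle (2 * Real.pi), ℂ)}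
    (hq : q ∈ Submodule.span ℂ (range (@fourier (2 * Real.pi)))) :
    ∃ P Q : ℂ → ℂ, Differentiable ℂ P ∧ Differentiable ℂ Q ∧
      ∀ x, q x = P (AddCircle.toCircle x) + star (Q (AddCircle.toCircle x)) := by
  induction hq using Submodule.span_induction with
  | mem q hq =>
    obtain ⟨k, rfl⟩ := hq
    obtain ⟨m, rfl | rfl⟩ := k.eq_nat_or_neg
    · exact ⟨fun z => z ^ m, 0, by fun_prop, by fun_prop, fun x => by
        simp [fourier_apply, AddCircle.toCircle_nsmul]⟩
    · exact ⟨0, fun z => z ^ m, by fun_prop, by fun_prop, fun x => by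
        simp [fourier_apply, AddCircle.toCircle_neg, AddCircle.toCircle_nsmul, ← Circle.coe_inv_eq_conj]⟩
  | zero => exact ⟨0, 0, by fun_prop, by fun_prop, fun x => by simp⟩
  | add q r _ _ hq hr =>
    obtain ⟨P, Q, hP, hQ, h⟩ := hq
    obtain ⟨P', Q', hP', hQ', h'⟩ := hr
    exact ⟨P + P', Q + Q', hP.add hP', hQ.add hQ', fun x => by
      simp [h, h']
      ring⟩
  | smul a q _ hq =>
    obtain ⟨P, Q, hP, hQ, h⟩ := hq
    exact ⟨a • P, star a • Q, hP.const_smul a, hQ.const_smul _, fun x => by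
      simp [h]
      ring⟩

lemma exists_entire_re_near_on_circle {u : ℂ → ℝ} (hu : Continuous u) :
    ∃ P : ℂ → ℂ, Differentiable ℂ P ∧ ∀ z, ‖z‖ = 1 → |u z - (P z).re| ≤ 1 := by
  have : Fact (0 < 2 * Real.pi) := ⟨Real.two_pi_pos⟩
  let f : C(AddCircle (2 * Real.pi), ℂ) :=
    ⟨fun x => (u (AddCircle.toCircle x) : ℂ), by
      have := AddCircle.continuous_toCircle (T := 2 * Real.pi)
      fun_prop⟩
  have hf : f ∈ (Submodule.span ℂ (range (@fourier (2 * Real.pi)))).topologicalClosure := by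
    rw [span_fourier_closure_eq_top]
    trivial
  obtain ⟨q, hq, hfq⟩ := Metric.mem_closure_iff.1 hf 1 one_pos
  obtain ⟨P, Q, hP, hQ, h⟩ := exists_entire_of_mem_span_fourier hq
  refine ⟨P + Q, hP.add hQ, fun z hz => ?_⟩
  obtain ⟨x, hx⟩ := (AddCircle.homeomorphCircle Real.two_pi_pos.ne').surjective
    (⟨z, by simpa [Submonoid.unitSphere] using hz⟩ : Circle)
  have hxz : (AddCircle.toCircle x : ℂ) = z := by
    rw [← AddCircle.homeomorphCircle_apply Real.two_pi_pos.ne', hx]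
  have h1 : ‖f x - q x‖ ≤ 1 := by
    rw [← dist_eq_norm]
    exact (ContinuousMap.dist_apply_le_dist x).trans hfq.le
  have h2 := (Complex.abs_re_le_norm _).trans h1
  simpa [f, h, hxz] using h2

/-- A `C²` function on `ℂ` whose Laplacian is nonnegative and bounded is, on the unit disc, within
bounded distance of the real part of an entire function. -/
lemma exists_entire_re_near {u : ℂ → ℝ} (hu : ContDiff ℝ 2 u) {C : ℝ}
    (hnn : ∀ z, 0 ≤ (Δ u) z) (hC : ∀ z, (Δ u) z ≤ 4 * C) :
    ∃ P : ℂ → ℂ, Differentiable ℂ P ∧ ∀ z, ‖z‖ ≤ 1 → |u z - (P z).re| ≤ C + 1 := by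
  obtain ⟨P, hP, hb⟩ := exists_entire_re_near_on_circle hu.continuous
  have hC0 : 0 ≤ C := by linarith [hnn 0, hC 0]
  have hPc := contDiff_re hP
  have hq : ContDiff ℝ 2 (C • fun w : ℂ => ‖w‖ ^ 2) := contDiff_norm_sq_complex.const_smul C
  have hsub : ContDiff ℝ 2 ((fun w => (P w).re) - u) := hPc.sub hu
  refine ⟨P, hP, fun z hz => abs_le.2 ⟨?_, ?_⟩⟩
  · have key := le_of_laplacian_nonneg
      (u := (C • fun w : ℂ => ‖w‖ ^ 2) + ((fun w => (P w).re) - u)) (hq.add hsub)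
      (fun w => by
        rw [hq.contDiffAt.laplacian_add hsub.contDiffAt,
          hPc.contDiffAt.laplacian_sub hu.contDiffAt,
          laplacian_smul _ contDiff_norm_sq_complex.contDiffAt, laplacian_norm_sq,
          laplacian_re_eq_zero hP]
        have := hC w
        simp only [smul_eq_mul]
        linarith) (m := C + 1)
      (fun w hw => by
        have := (abs_le.1 (hb w hw)).1
        simp [hw]
        linarith) hz
    simp only [Pi.add_apply, Pi.sub_apply, Pi.smul_apply, smul_eq_mul] at key
    have : 0 ≤ C * ‖z‖ ^ 2 := by positivity
    linarith
  · have key := le_of_laplacian_nonneg (u := u - fun w => (P w).re) (hu.sub hPc)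
      (fun w => by
        rw [hu.contDiffAt.laplacian_sub hPc.contDiffAt, laplacian_re_eq_zero hP]
        simpa using hnn w) (m := 1)
      (fun w hw => (abs_le.1 (hb w hw)).2) hz
    simp only [Pi.sub_apply] at key
    linarith

/-- Equicontinuity estimate for weighted entire functions of one variable. -/
lemma norm_mul_exp_neg_le_disc {u : ℂ → ℝ} (hu : ContDiff ℝ 2 u) {C : ℝ}
    (hnn : ∀ z, 0 ≤ (Δ u) z) (hC : ∀ z, (Δ u) z ≤ 4 * C) {f : ℂ → ℂ} (hf : Differentiable ℂ f)
    {A : ℝ} (hA : ∀ z, ‖f z‖ * Real.exp (-u z) ≤ A) {s : ℂ} (hs : ‖s‖ < 1) :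
    ‖f s‖ * Real.exp (-u s) ≤ Real.exp (C + 1) ^ 2 * (‖f 0‖ * Real.exp (-u 0)) +
      2 * Real.exp (C + 1) ^ 2 * A * ‖s‖ := by
  obtain ⟨P, hP, hb⟩ := exists_entire_re_near hu hnn hC
  set E := Real.exp (C + 1) with hE
  have hEpos : 0 < E := Real.exp_pos _
  let g : ℂ → ℂ := fun z => f z * Complex.exp (-P z)
  have hg : Differentiable ℂ g := hf.mul hP.neg.cexp
  have hgn (z : ℂ) : ‖g z‖ = ‖f z‖ * Real.exp (-u z) * Real.exp (u z - (P z).re) := by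
    simp only [g, norm_mul, Complex.norm_exp, Complex.neg_re]
    rw [mul_assoc, ← Real.exp_add]
    ring_nf
  have hle (z : ℂ) (hz : ‖z‖ ≤ 1) : ‖g z‖ ≤ E * (‖f z‖ * Real.exp (-u z)) := by
    rw [hgn, mul_comm]
    gcongr
    exact Real.exp_le_exp.2 (abs_le.1 (hb z hz)).2
  have hge (z : ℂ) (hz : ‖z‖ ≤ 1) : ‖f z‖ * Real.exp (-u z) ≤ E * ‖g z‖ := by
    have h1 : 1 ≤ E * Real.exp (u z - (P z).re) := by
      rw [hE, ← Real.exp_add]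
      exact Real.one_le_exp (by linarith [(abs_le.1 (hb z hz)).1])
    rw [hgn]
    have h2 : 0 ≤ ‖f z‖ * Real.exp (-u z) := by positivity
    nlinarith
  have hgA (z : ℂ) (hz : ‖z‖ ≤ 1) : ‖g z‖ ≤ E * A :=
    (hle z hz).trans (by gcongr; exact hA z)
  have hschwarz : dist (g s) (g 0) ≤ 2 * (E * A) / 1 * dist s 0 := by
    refine Complex.dist_le_div_mul_dist_of_mapsTo_ball hg.differentiableOn (fun z hz => ?_)
      (by simpa using hs)
    have hz' : ‖z‖ ≤ 1 := by simpa using (mem_ball.1 hz).le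
    rw [mem_closedBall, dist_eq_norm]
    linarith [norm_sub_le (g z) (g 0), hgA z hz', hgA 0 (by simp)]
  rw [dist_eq_norm, dist_zero_right, div_one] at hschwarz
  have h3 : ‖g s‖ ≤ E * (‖f 0‖ * Real.exp (-u 0)) + 2 * (E * A) * ‖s‖ := by
    linarith [norm_sub_norm_le (g s) (g 0), hle 0 (by simp)]
  calc ‖f s‖ * Real.exp (-u s) ≤ E * ‖g s‖ := hge s hs.le
    _ ≤ E * (E * (‖f 0‖ * Real.exp (-u 0)) + 2 * (E * A) * ‖s‖) := by gcongr
    _ = _ := by ring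

lemma laplacian_comp_complex_line {n : ℕ} {φ : En n → ℝ} (hφ : ContDiff ℝ 2 φ) (a v : En n)
    (ζ : ℂ) : (Δ fun w : ℂ => φ (a + w • v)) ζ = 4 * levi φ (a + ζ • v) v := by
  have hu : ContDiff ℝ 2 fun w : ℂ => φ (a + w • v) := hφ.comp (by fun_prop)
  rw [laplacian_complex_eq, ← deriv_deriv_line hu, ← deriv_deriv_line hu, levi, hess, hess,
    ← deriv_deriv_line hφ, ← deriv_deriv_line hφ]
  simp only [add_smul, smul_assoc, one_smul, add_assoc]
  ring

/-- Equicontinuity estimate for weighted entire functions on `ℂⁿ`. -/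
lemma norm_mul_exp_neg_le {n : ℕ} {φ : En n → ℝ} (hφ : ContDiff ℝ 2 φ) {C : ℝ} (hC : 0 ≤ C)
    (hl : ∀ z v : En n, 0 ≤ levi φ z v) (hu : ∀ z v : En n, levi φ z v ≤ C * ‖v‖ ^ 2)
    {F : En n → ℂ} (hF : Differentiable ℂ F) {A : ℝ}
    (hA : ∀ z, ‖F z‖ * Real.exp (-φ z) ≤ A) {δ : ℝ} (hδ : 0 < δ) (hδ1 : δ < 1) {a w : En n}
    (haw : dist w a ≤ δ) :
    ‖F w‖ * Real.exp (-φ w) ≤ Real.exp (C + 1) ^ 2 * (‖F a‖ * Real.exp (-φ a)) +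
      2 * Real.exp (C + 1) ^ 2 * A * δ := by
  let v : En n := (δ⁻¹ : ℂ) • (w - a)
  have hv : ‖v‖ ≤ 1 := by
    rw [norm_smul, ← dist_eq_norm, norm_inv, Complex.norm_real, Real.norm_of_nonneg hδ.le,
      inv_mul_le_iff₀ hδ]
    simpa using haw
  have hw : a + (δ : ℂ) • v = w := by
    simp only [v]
    rw [smul_smul, mul_inv_cancel₀ (by exact_mod_cast hδ.ne'), one_smul, add_sub_cancel]
  have hd : ‖(δ : ℂ)‖ = δ := by rw [Complex.norm_real, Real.norm_of_nonneg hδ.le]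
  have := norm_mul_exp_neg_le_disc (u := fun ζ : ℂ => φ (a + ζ • v)) (C := C)
    (f := fun ζ : ℂ => F (a + ζ • v)) (A := A) (s := (δ : ℂ)) (hφ.comp (by fun_prop))
    (fun ζ => by
      rw [laplacian_comp_complex_line hφ]
      linarith [hl (a + ζ • v) v])
    (fun ζ => by
      rw [laplacian_comp_complex_line hφ]
      have h1 : ‖v‖ ^ 2 ≤ 1 := pow_le_one₀ (norm_nonneg v) hv
      nlinarith [hu (a + ζ • v) v])
    (hF.comp (by fun_prop)) (fun ζ => hA _) (by rw [hd]; exact hδ1)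
  simpa only [zero_smul, add_zero, hw, hd] using this

lemma exists_separated_net {X : Type*} [PseudoMetricSpace X] (W : Set X) {δ : ℝ} (hδ : 0 < δ) :
    ∃ S ⊆ W, (S.Pairwise fun x y => δ ≤ dist x y) ∧ ∀ w ∈ W, ∃ σ ∈ S, dist w σ < δ := by
  obtain ⟨S, hS⟩ := zorn_subset {S : Set X | S ⊆ W ∧ S.Pairwise fun x y => δ ≤ dist x y}
    (fun c hc hchain => ⟨⋃₀ c, ⟨sUnion_subset fun s hs => (hc hs).1,
      (pairwise_sUnion hchain.directedOn).2 fun s hs => (hc hs).2⟩,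
      fun s hs => subset_sUnion_of_mem hs⟩)
  refine ⟨S, hS.prop.1, hS.prop.2, fun w hw => ?_⟩
  by_contra! hfar
  have hins : insert w S ∈ {S : Set X | S ⊆ W ∧ S.Pairwise fun x y => δ ≤ dist x y} :=
    ⟨insert_subset hw hS.prop.1, hS.prop.2.insert fun y hy _ =>
      ⟨hfar y hy, by rw [dist_comm]; exact hfar y hy⟩⟩
  have := hfar w (hS.le_of_ge hins (subset_insert w S) (mem_insert w S))
  rw [dist_self] at this
  linarith

end

/-- **Lemma (discretization of an `∞`-sampling hypersurface).**  If `cω ≤ i∂∂̄φ ≤ Cω`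
and the uniformly flat hypersurface `W = T⁻¹(0)` is sampling for `BF^∞_φ(ℂⁿ)`
(`sup_{ℂⁿ}|F|e^{-φ} ≤ M sup_W |F|e^{-φ}`), then some uniformly separated `Σ ⊂ W` is a
sampling sequence for `BF^∞_φ(ℂⁿ)`. -/
theorem sampling_hypersurface_discretization
    (n : ℕ) (φ : En n → ℝ) (hφ : ContDiff ℝ 2 φ)
    (c C : ℝ) (hc : 0 < c) (hcC : c ≤ C)
    (hl : ∀ z v : En n, c * ‖v‖ ^ 2 ≤ levi φ z v)
    (hu : ∀ z v : En n, levi φ z v ≤ C * ‖v‖ ^ 2)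
    (T : En n → ℂ) (hT : Differentiable ℂ T)
    (W : Set (En n)) (hWT : W = T ⁻¹' {0})
    (hdT : ∀ z ∈ W, fderiv ℂ T z ≠ 0)
    (hflat : UniformlyFlat W)
    (hsamp : ∃ M > (0 : ℝ), ∀ F : En n → ℂ, Differentiable ℂ F →
      (⨆ z : En n, ENNReal.ofReal (‖F z‖ * Real.exp (-φ z))) < ⊤ →
      (⨆ z : En n, ENNReal.ofReal (‖F z‖ * Real.exp (-φ z))) ≤
        ENNReal.ofReal M * ⨆ z ∈ W, ENNReal.ofReal (‖F z‖ * Real.exp (-φ z))) :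
    ∃ S : Set (En n), S ⊆ W ∧ UnifSep S ∧
      ∃ M > (0 : ℝ), ∀ F : En n → ℂ, Differentiable ℂ F →
        (⨆ z : En n, ENNReal.ofReal (‖F z‖ * Real.exp (-φ z))) < ⊤ →
        (⨆ z : En n, ENNReal.ofReal (‖F z‖ * Real.exp (-φ z))) ≤
          ENNReal.ofReal M * ⨆ σ ∈ S, ENNReal.ofReal (‖F σ‖ * Real.exp (-φ σ)) := by
  have hC0 : 0 ≤ C := hc.le.trans hcC
  obtain ⟨M, hM, hsamp⟩ := hsamp
  set K : ℝ := Real.exp (C + 1) ^ 2 with hK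
  have hKpos : 0 < K := by positivity
  set δ : ℝ := min (1 / 2) (1 / (4 * K * M)) with hδdef
  have hδ : 0 < δ := by positivity
  have hδ1 : δ < 1 := (min_le_left _ _).trans_lt (by norm_num)
  have hδM : M * (2 * K * δ) ≤ 1 / 2 := by
    have h : δ ≤ 1 / (4 * K * M) := min_le_right _ _
    rw [le_div_iff₀ (by positivity)] at h
    linarith
  obtain ⟨S, hSW, hsep, hnet⟩ := exists_separated_net W hδ
  refine ⟨S, hSW, ⟨δ, hδ, fun x hx y hy hxy => hsep hx hy hxy⟩, 2 * M * K, by positivity,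
    fun F hF hfin => ?_⟩
  have hbound := hsamp F hF hfin
  set N := ⨆ z : En n, ENNReal.ofReal (‖F z‖ * Real.exp (-φ z)) with hN
  set B := ⨆ σ ∈ S, ENNReal.ofReal (‖F σ‖ * Real.exp (-φ σ)) with hB
  have hBN : B ≤ N := iSup₂_le fun σ _ =>
    le_iSup (fun z : En n => ENNReal.ofReal (‖F z‖ * Real.exp (-φ z))) σ
  have hBfin : B ≠ ⊤ := (hBN.trans_lt hfin).ne
  have hA (z : En n) : ‖F z‖ * Real.exp (-φ z) ≤ N.toReal :=
    (ENNReal.ofReal_le_iff_le_toReal hfin.ne).1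
      (le_iSup (fun z : En n => ENNReal.ofReal (‖F z‖ * Real.exp (-φ z))) z)
  have hW : (⨆ z ∈ W, ENNReal.ofReal (‖F z‖ * Real.exp (-φ z))) ≤
      ENNReal.ofReal (K * B.toReal + 2 * K * N.toReal * δ) := by
    refine iSup₂_le fun w hw => ENNReal.ofReal_le_ofReal ?_
    obtain ⟨σ, hσ, hwσ⟩ := hnet w hw
    have hσB : ‖F σ‖ * Real.exp (-φ σ) ≤ B.toReal :=
      (ENNReal.ofReal_le_iff_le_toReal hBfin).1
        (le_iSup₂ (f := fun σ (_ : σ ∈ S) => ENNReal.ofReal (‖F σ‖ * Real.exp (-φ σ))) σ hσ)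
    refine (norm_mul_exp_neg_le hφ hC0 (fun z v => le_trans (by positivity) (hl z v)) hu hF hA hδ
      hδ1 hwσ.le).trans ?_
    gcongr
  have hreal : N.toReal ≤ M * (K * B.toReal + 2 * K * N.toReal * δ) := by
    have h : N ≤ ENNReal.ofReal (M * (K * B.toReal + 2 * K * N.toReal * δ)) := by
      rw [ENNReal.ofReal_mul hM.le]
      exact hbound.trans (mul_le_mul_right hW _)
    exact ENNReal.toReal_le_of_le_ofReal (by positivity) h
  have hfinal : N.toReal ≤ 2 * M * K * B.toReal := by
    nlinarith [mul_le_mul_of_nonneg_right hδM (ENNReal.toReal_nonneg (a := N))]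
  calc N = ENNReal.ofReal N.toReal := (ENNReal.ofReal_toReal hfin.ne).symm
    _ ≤ ENNReal.ofReal (2 * M * K * B.toReal) := ENNReal.ofReal_le_ofReal hfinal
    _ = ENNReal.ofReal (2 * M * K) * B := by
      rw [ENNReal.ofReal_mul (by positivity), ENNReal.ofReal_toReal hBfin]
end
end
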